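/- Let L be a frame. A D-sublocale S ∈ S_D(L) satisfies: S ≠ {1}, and whenever S = ⋁_{i∈I} S_i with each S_i ∈ S_D(L) (join computed in S(L)) there exists i with S = S_i — that is, S is a covered prime of the frame S_D(L)^op — if and only if S = {1, p} for some covered prime p ∈ pt_D(L). -/

import Mathlib

open Set

universe u

namespace TD

variable {L : Type u} [Order.Frame L]

/-- A sublocale of a frame `L`: a subset closed under arbitrary meets and
under `a ⇨ -` for every `a : L`. -/
def IsSublocale (S : Set L) : Prop :=
  (∀ A : Set L, A ⊆ S → sInf A ∈ S) ∧ ∀ a : L, ∀ s ∈ S, (a ⇨ s) ∈ S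

/-- The covered primes of the (sub)frame `S` (meets computed in `L`,
which agree with meets in `S` when `S` is a sublocale).  The covered primes
of `L` itself are `ptD (Set.univ)`. -/
def ptD (S : Set L) : Set L :=
  {p | p ∈ S ∧ p ≠ ⊤ ∧ ∀ A : Set L, A ⊆ S → sInf A = p → p ∈ A}

/-- The primes of the (sub)frame `S`.  The primes of `L` itself are
`pt (Set.univ)`. -/
def pt (S : Set L) : Set L :=
  {p | p ∈ S ∧ p ≠ ⊤ ∧ ∀ x ∈ S, ∀ y ∈ S, p = x ⊓ y → p = x ∨ p = y}

/-- A D-sublocale: a sublocale all of whose covered primes are covered primes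
of the ambient frame `L`. -/
def IsDSublocale (S : Set L) : Prop :=
  IsSublocale S ∧ ptD S ⊆ ptD (univ : Set L)

/-- The join, computed in the coframe `S(L)` of all sublocales, of a family of
subsets of `L`: all meets of subsets of the union. -/
def sJoin (𝒮 : Set (Set L)) : Set L :=
  {x | ∃ A : Set L, A ⊆ ⋃₀ 𝒮 ∧ sInf A = x}

/-- Binary join in `S(L)`. -/
def join2 (S T : Set L) : Set L := sJoin {S, T}

/-- The closed sublocale `c(a) = ↑a`. -/
def closedSub (a : L) : Set L := Ici a

/-- The open sublocale `o(a) = {a ⇨ b | b ∈ L}`. -/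
def openSub (a : L) : Set L := {x | ∃ b : L, x = a ⇨ b}

/-- The Boolean sublocale `b(a) = {x ⇨ a | x ∈ L}`. -/
def bSub (a : L) : Set L := {x | ∃ y : L, x = y ⇨ a}

/-- A complemented sublocale: one having a complement in the coframe `S(L)`
(whose bottom is `{⊤}` and top is `L` itself, i.e. `Set.univ`). -/
def IsComplementedSublocale (C : Set L) : Prop :=
  IsSublocale C ∧ ∃ C' : Set L, IsSublocale C' ∧ C ∩ C' = {⊤} ∧ join2 C C' = univ

/-- A smooth sublocale: a join in `S(L)` of complemented sublocales. -/
def IsSmooth (S : Set L) : Prop :=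
  ∃ 𝒞 : Set (Set L), (∀ C ∈ 𝒞, IsComplementedSublocale C) ∧ S = sJoin 𝒞

/-- `M Y`: the closure of `Y` under arbitrary meets (with `⋀ ∅ = ⊤`). -/
def M (Y : Set L) : Set L := {x | ∃ A : Set L, A ⊆ Y ∧ sInf A = x}

/-- The (sub)frame `S` is `T_D`-spatial: every element of `S` is a meet of
covered primes of `S`. -/
def IsTDSpatialSub (S : Set L) : Prop :=
  ∀ s ∈ S, ∃ P : Set L, P ⊆ ptD S ∧ sInf P = s

/-- The (sub)frame `S` is spatial: every element of `S` is a meet of primes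
of `S`. -/
def IsSpatialSub (S : Set L) : Prop :=
  ∀ s ∈ S, ∃ P : Set L, P ⊆ pt S ∧ sInf P = s

/-- The primes of `L` lying above `a`, i.e. `pt(↑a)`. -/
def ptAbove (a : L) : Set L := {p | p ∈ pt (univ : Set L) ∧ a ≤ p}

/-- A prime of the frame `S_D(L)^op` (order-reversed coframe of D-sublocales):
a D-sublocale `P ≠ {⊤}` such that `P = S₁ ∨ S₂` (join in `S(L)`) with
`S₁, S₂` D-sublocales implies `P = S₁` or `P = S₂`. -/
def PrimeInSDop (P : Set L) : Prop :=
  IsDSublocale P ∧ P ≠ ({⊤} : Set L) ∧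
    ∀ S₁ S₂ : Set L, IsDSublocale S₁ → IsDSublocale S₂ →
      P = join2 S₁ S₂ → P = S₁ ∨ P = S₂

/-- A covered prime of the frame `S_D(L)^op`: a D-sublocale `P ≠ {⊤}` such
that whenever `P` is a join of a family of D-sublocales, it equals one of
them. -/
def CovPrimeInSDop (P : Set L) : Prop :=
  IsDSublocale P ∧ P ≠ ({⊤} : Set L) ∧
    ∀ 𝒮 : Set (Set L), (∀ T ∈ 𝒮, IsDSublocale T) → P = sJoin 𝒮 → ∃ T ∈ 𝒮, P = T

/-- A prime of the frame `S(L)^op`. -/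
def PrimeInSop (P : Set L) : Prop :=
  IsSublocale P ∧ P ≠ ({⊤} : Set L) ∧
    ∀ S₁ S₂ : Set L, IsSublocale S₁ → IsSublocale S₂ →
      P = join2 S₁ S₂ → P = S₁ ∨ P = S₂

/-- A prime of the frame `S_b(L)^op` of smooth sublocales. -/
def PrimeInSbop (P : Set L) : Prop :=
  IsSmooth P ∧ P ≠ ({⊤} : Set L) ∧
    ∀ S₁ S₂ : Set L, IsSmooth S₁ → IsSmooth S₂ →
      P = join2 S₁ S₂ → P = S₁ ∨ P = S₂

/-- A prime element of a complete lattice. -/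
def IsPrimeElt {α : Type*} [CompleteLattice α] (p : α) : Prop :=
  p ≠ ⊤ ∧ ∀ x y : α, p = x ⊓ y → p = x ∨ p = y

/-- A `T_D` topological space: `T₀` and every point has an open
neighbourhood `U` with `U \ {x}` open. -/
def IsTDSpace (X : Type*) [TopologicalSpace X] : Prop :=
  T0Space X ∧ ∀ x : X, ∃ U : Set X, IsOpen U ∧ x ∈ U ∧ IsOpen (U \ {x})

/-- A sober space: every prime of the frame of opens is of the form
`X ∖ cl {x}` for a unique point `x`. -/
def IsSoberSpace (X : Type*) [TopologicalSpace X] : Prop :=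
  ∀ p : TopologicalSpace.Opens X, IsPrimeElt p →
    ∃! x : X, p = ⟨(closure {x})ᶜ, isClosed_closure.isOpen_compl⟩


theorem sJoin_subset {S : Set L} {𝒮 : Set (Set L)} (hS : IsSublocale S)
    (h : ∀ T ∈ 𝒮, T ⊆ S) : sJoin 𝒮 ⊆ S := by
  rintro _ ⟨A, hA, rfl⟩
  exact hS.1 A (hA.trans (sUnion_subset h))

theorem subset_sJoin {T : Set L} {𝒮 : Set (Set L)} (hT : T ∈ 𝒮) : T ⊆ sJoin 𝒮 := fun x hx =>
  ⟨{x}, singleton_subset_iff.2 ⟨T, hT, hx⟩, sInf_singleton⟩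

theorem IsSublocale.top_mem {S : Set L} (hS : IsSublocale S) : ⊤ ∈ S := by
  simpa using hS.1 ∅ (empty_subset S)

/-- The part of a D-sublocale in a closed sublocale is a D-sublocale. -/
theorem IsDSublocale.inter_closedSub {S : Set L} (hS : IsDSublocale S) (a : L) :
    IsDSublocale (S ∩ closedSub a) := by
  refine ⟨⟨fun A hA => ⟨hS.1.1 A fun x hx => (hA hx).1, le_sInf fun x hx => (hA hx).2⟩,
    fun b s hs => ⟨hS.1.2 b s hs.1, le_trans hs.2 le_himp⟩⟩, ?_⟩
  rintro p ⟨⟨hpS, hap⟩, hp, h⟩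
  refine hS.2 ⟨hpS, hp, fun A hA hAp => h A (fun x hx => ⟨hA hx, ?_⟩) hAp⟩
  exact le_trans hap (hAp ▸ sInf_le hx)

theorem mem_openSub_iff {a x : L} : x ∈ openSub a ↔ a ⇨ x = x := by
  constructor
  · rintro ⟨b, rfl⟩
    exact himp_idem
  · exact fun h => ⟨x, h.symm⟩

theorem himp_sInf_eq_sInf_image (a : L) (A : Set L) :
    a ⇨ sInf A = sInf ((a ⇨ ·) '' A) := by
  rw [sInf_image]
  refine le_antisymm (le_iInf₂ fun x hx => himp_le_himp_left (sInf_le hx)) ?_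
  rw [le_himp_iff]
  exact le_sInf fun x hx => le_himp_iff.1 (iInf₂_le x hx)

/-- The part of a D-sublocale in an open sublocale is a D-sublocale. -/
theorem IsDSublocale.inter_openSub {S : Set L} (hS : IsDSublocale S) (a : L) :
    IsDSublocale (S ∩ openSub a) := by
  refine ⟨⟨fun A hA => ⟨hS.1.1 A fun x hx => (hA hx).1, ?_⟩,
    fun b s hs => ⟨hS.1.2 b s hs.1, ?_⟩⟩, ?_⟩
  · rw [mem_openSub_iff, himp_sInf_eq_sInf_image,
      image_congr fun x hx => mem_openSub_iff.1 (hA hx).2, image_id']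
  · rw [mem_openSub_iff, himp_left_comm, mem_openSub_iff.1 hs.2]
  · rintro p ⟨⟨hpS, hap⟩, hp, h⟩
    refine hS.2 ⟨hpS, hp, fun A hA hAp => ?_⟩
    obtain ⟨x, hx, hxp⟩ : p ∈ (a ⇨ ·) '' A := by
      refine h _ ?_ ?_
      · rintro _ ⟨x, hx, rfl⟩
        exact ⟨hS.1.2 a x (hA hx), x, rfl⟩
      · rw [← himp_sInf_eq_sInf_image, hAp, mem_openSub_iff.1 hap]
    have hxe : x = p := le_antisymm (le_himp.trans hxp.le) (hAp ▸ sInf_le hx)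
    exact hxe ▸ hx

theorem IsSublocale.eq_join2_closedSub_openSub {S : Set L} (hS : IsSublocale S) (a : L) :
    S = join2 (S ∩ closedSub a) (S ∩ openSub a) := by
  refine Subset.antisymm (fun s hs => ?_) (sJoin_subset hS ?_)
  · refine ⟨{(a ⇨ s) ⇨ s, a ⇨ s}, ?_, ?_⟩
    · rintro x (rfl | rfl)
      · exact ⟨_, Or.inl rfl, hS.2 _ s hs, le_himp_himp⟩
      · exact ⟨_, Or.inr rfl, hS.2 a s hs, s, rfl⟩
    · rw [sInf_pair, himp_inf_self, inf_eq_left]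
      exact le_himp
  · rintro T (rfl | rfl) <;> exact inter_subset_left

theorem mem_ptD_pair {p : L} (hp : p ≠ ⊤) : p ∈ ptD ({⊤, p} : Set L) := by
  refine ⟨Or.inr rfl, hp, fun A hA hAp => ?_⟩
  by_contra hpA
  refine hp (hAp ▸ sInf_eq_top.2 fun x hx => ?_)
  exact (hA hx).resolve_right fun hxp => hpA (hxp ▸ hx)

/-- a D-sublocale `S` is a covered prime of the frame
`S_D(L)^op` (i.e. `S ≠ {⊤}` and whenever `S` is a join of a family of
D-sublocales it equals one of them) iff `S = {⊤, p}` for some covered prime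
`p` of `L`. -/
theorem covPrime_SDop_iff (S : Set L) (hS : IsDSublocale S) :
    (S ≠ ({⊤} : Set L) ∧
      ∀ 𝒮 : Set (Set L), (∀ T ∈ 𝒮, IsDSublocale T) → S = sJoin 𝒮 →
        ∃ T ∈ 𝒮, S = T) ↔
    ∃ p ∈ ptD (univ : Set L), S = ({⊤, p} : Set L) := by
  constructor
  · rintro ⟨hne, h⟩
    have hle : ∀ a ∈ S, a ≠ ⊤ → ∀ b ∈ S, a ≤ b := by
      intro a ha hat b hb
      obtain ⟨T, hT, hST⟩ := h {S ∩ closedSub a, S ∩ openSub a}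
        (by
          rintro T (rfl | rfl)
          exacts [hS.inter_closedSub a, hS.inter_openSub a])
        (hS.1.eq_join2_closedSub_openSub a)
      rcases hT with rfl | rfl
      · exact (hST ▸ hb : b ∈ S ∩ closedSub a).2
      · have haa := mem_openSub_iff.1 (hST ▸ ha : a ∈ S ∩ openSub a).2
        exact absurd (haa.symm.trans himp_self) hat
    obtain ⟨p, hpS, hp⟩ : ∃ p ∈ S, p ≠ ⊤ := by
      by_contra! hall
      exact hne (Subset.antisymm hall (singleton_subset_iff.2 hS.1.top_mem))
    have hSp : S = {⊤, p} := by
      refine Subset.antisymm (fun x hx => ?_) (pair_subset hS.1.top_mem hpS)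
      by_cases hxt : x = ⊤
      · exact Or.inl hxt
      · exact Or.inr (le_antisymm (hle x hx hxt p hpS) (hle p hpS hp x hx))
    exact ⟨p, hS.2 (hSp ▸ mem_ptD_pair hp), hSp⟩
  · rintro ⟨p, ⟨-, hp, -⟩, rfl⟩
    refine ⟨fun h => hp (h ▸ Or.inr rfl : p ∈ ({⊤} : Set L)), fun 𝒮 h𝒮 hS𝒮 => ?_⟩
    obtain ⟨A, hA, hAp⟩ : p ∈ sJoin 𝒮 := hS𝒮 ▸ Or.inr rfl
    have hsub : ∀ T ∈ 𝒮, T ⊆ {⊤, p} := fun T hT => hS𝒮 ▸ subset_sJoin hT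
    obtain ⟨T, hT, hpT⟩ := hA ((mem_ptD_pair hp).2.2 A (hA.trans (sUnion_subset hsub)) hAp)
    exact ⟨T, hT, Subset.antisymm (pair_subset (h𝒮 T hT).1.top_mem hpT) (hsub T hT)⟩

end TD
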